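/- Let X be a measurable space, P a finite set, ρ_X a probability measure on X, π(·|x) a Markov kernel from X to P, F, H separable real Hilbert spaces, Φ : X×P → F bounded measurable, and suppose there exists a Hilbert–Schmidt operator 𝖦 : F → H with g*(x,p) = 𝖦 Φ(x,p) for all (x,p). Let 𝔠 = ∫ ζ_{x,p} ζ_{x,p'} dπ(p|x) dπ(p'|x) dρ_X(x) with ζ_{x,p} = Φ(x,p)⊗Φ(x,p) − C, C = E[Φ(x,p)⊗Φ(x,p)], and let 𝔅 have trace T_B = 𝔟₁ − 𝔟₂ as above with this g*. Then 𝔠 is positive semidefinite, T_B = Tr(𝖦*𝖦 𝔠), and T_B ≤ ‖𝖦‖² Tr(𝔠), where ‖𝖦‖ is the operator norm. -/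

import Mathlib

noncomputable section

open MeasureTheory RealInnerProductSpace ContinuousLinearMap

/-- The rank-one operator `u ⊗ v : w ↦ ⟨v, w⟩ • u`. -/
def rankOne {E H : Type*} [NormedAddCommGroup E] [InnerProductSpace ℝ E]
    [NormedAddCommGroup H] [InnerProductSpace ℝ H] (u : H) (v : E) : E →L[ℝ] H :=
  (innerSL ℝ v).smulRight u

/-- The trace of `T : E → E` along a Hilbert basis of `E`. -/
def traceAlong {ι E : Type*} [NormedAddCommGroup E] [InnerProductSpace ℝ E]
    (b : HilbertBasis ι ℝ E) (T : E →L[ℝ] E) : ℝ :=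
  ∑' i, ⟪(b i : E), T (b i)⟫

theorem HilbertBasis.secondCountableTopology {ι E : Type*} [Countable ι] [NormedAddCommGroup E]
    [InnerProductSpace ℝ E] (b : HilbertBasis ι ℝ E) : SecondCountableTopology E := by
  have hsep : TopologicalSpace.IsSeparable (Set.univ : Set E) := by
    have h := ((Set.countable_range b).isSeparable.span (R := ℝ)).closure
    rw [← Submodule.topologicalClosure_coe, b.dense_span] at h
    simpa using h
  have : TopologicalSpace.SeparableSpace E := TopologicalSpace.isSeparable_univ_iff.mp hsep
  exact UniformSpace.secondCountable_of_separable E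

theorem HilbertBasis.hasSum_integral_inner_mul_inner {ι E Ω : Type*} [Countable ι]
    [NormedAddCommGroup E] [InnerProductSpace ℝ E] [MeasurableSpace Ω] {μ : Measure Ω}
    (b : HilbertBasis ι ℝ E) {f g : Ω → E} (hf : MemLp f 2 μ) (hg : MemLp g 2 μ) :
    HasSum (fun i => ∫ z, ⟪(b i : E), f z⟫ * ⟪g z, b i⟫ ∂μ) (∫ z, ⟪g z, f z⟫ ∂μ) := by
  have parseval (u : E) : HasSum (fun i => ⟪(b i : E), u⟫ ^ 2) (‖u‖ ^ 2) := by
    simpa [real_inner_comm, sq] using b.hasSum_inner_mul_inner u u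
  have hsum (z : Ω) : HasSum (fun i => ⟪(b i : E), f z⟫ ^ 2 + ⟪(b i : E), g z⟫ ^ 2)
      (‖f z‖ ^ 2 + ‖g z‖ ^ 2) := (parseval _).add (parseval _)
  refine hasSum_integral_of_dominated_convergence
    (fun i z => ⟪(b i : E), f z⟫ ^ 2 + ⟪(b i : E), g z⟫ ^ 2) (fun i => ?_)
    (fun i => .of_forall fun z => ?_) (.of_forall fun z => (hsum z).summable) ?_
    (.of_forall fun z => ?_)
  · exact (aestronglyMeasurable_const.inner hf.1).mul (hg.1.inner aestronglyMeasurable_const)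
  · rw [real_inner_comm (b i) (g z), Real.norm_eq_abs, abs_le]
    constructor <;> nlinarith [sq_nonneg (⟪(b i : E), f z⟫ + ⟪(b i : E), g z⟫),
      sq_nonneg (⟪(b i : E), f z⟫ - ⟪(b i : E), g z⟫)]
  · simp_rw [fun z => (hsum z).tsum_eq]
    exact (hf.integrable_norm_pow two_ne_zero).add (hg.integrable_norm_pow two_ne_zero)
  · simpa only [mul_comm] using b.hasSum_inner_mul_inner (g z) (f z)

theorem norm_weight_le_one {X P : Type*} [Fintype P] {π : X → P → ℝ} (hπ0 : ∀ x p, 0 ≤ π x p)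
    (hπ1 : ∀ x, ∑ p, π x p = 1) (x : X) (p : P) : ‖π x p‖ ≤ 1 := by
  rw [Real.norm_of_nonneg (hπ0 x p), ← hπ1 x]
  exact Finset.single_le_sum (fun q _ => hπ0 x q) (Finset.mem_univ p)

theorem integrable_inner_mul_inner {X P F Ω : Type*} [Fintype P] [NormedAddCommGroup F]
    [InnerProductSpace ℝ F] [MeasurableSpace X] [MeasurableSpace Ω]
    {π : X → P → ℝ} {Φ : X → P → F} (hπ0 : ∀ x p, 0 ≤ π x p) (hπ1 : ∀ x, ∑ p, π x p = 1)
    (hπ : ∀ p, Measurable fun x => π x p) (hΦ : ∀ p, StronglyMeasurable fun x => Φ x p)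
    (hb : ∃ M, ∀ x p, ‖Φ x p‖ ≤ M) (N M : F →L[ℝ] F)
    (μ : Measure Ω) [IsFiniteMeasure μ] {s t : Ω → X} (hs : Measurable s) (ht : Measurable t)
    (p p' : P) :
    Integrable (fun z => π (s z) p * π (t z) p' *
      (⟪Φ (s z) p, M (Φ (t z) p')⟫ * ⟪Φ (s z) p, N (Φ (t z) p')⟫)) μ := by
  obtain ⟨K, hK⟩ := hb
  have h1 := (hΦ p).comp_measurable hs
  have h2 := (hΦ p').comp_measurable ht
  have hbound (L : F →L[ℝ] F) (z : Ω) :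
      ‖⟪Φ (s z) p, L (Φ (t z) p')⟫‖ ≤ K * (‖L‖ * K) :=
    (norm_inner_le_norm _ _).trans (mul_le_mul (hK _ _) (L.le_opNorm_of_le (hK _ _))
      (norm_nonneg _) ((norm_nonneg _).trans (hK (s z) p)))
  refine .of_bound (StronglyMeasurable.aestronglyMeasurable ?_)
    (1 * 1 * (K * (‖M‖ * K) * (K * (‖N‖ * K)))) (.of_forall fun z => ?_)
  · exact (((hπ p).comp hs).mul ((hπ p').comp ht)).stronglyMeasurable.mul
      ((h1.inner (M.continuous.comp_stronglyMeasurable h2)).mul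
        (h1.inner (N.continuous.comp_stronglyMeasurable h2)))
  · have hK0 : 0 ≤ K := (norm_nonneg _).trans (hK (s z) p)
    rw [norm_mul, norm_mul, norm_mul]
    gcongr
    · exact norm_weight_le_one hπ0 hπ1 _ _
    · exact norm_weight_le_one hπ0 hπ1 _ _
    · exact hbound M z
    · exact hbound N z

/-- The conditional second-moment operator `x ↦ ∑ p, π(p|x) Φ(x,p) ⊗ Φ(x,p)`. -/
def condSecondMoment {X P F : Type*} [Fintype P] [NormedAddCommGroup F] [InnerProductSpace ℝ F]
    (π : X → P → ℝ) (Φ : X → P → F) (x : X) : F →L[ℝ] F :=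
  ∑ p, π x p • rankOne (Φ x p) (Φ x p)

section condSecondMoment

variable {X P F : Type*} [Fintype P] [NormedAddCommGroup F] [InnerProductSpace ℝ F]
  {π : X → P → ℝ} {Φ : X → P → F}

theorem condSecondMoment_apply (x : X) (w : F) :
    condSecondMoment π Φ x w = ∑ p, (π x p * ⟪Φ x p, w⟫) • Φ x p := by
  simp [condSecondMoment, rankOne, mul_smul]

theorem inner_condSecondMoment_comm (x : X) (v w : F) :
    ⟪condSecondMoment π Φ x v, w⟫ = ⟪v, condSecondMoment π Φ x w⟫ := by
  simp only [condSecondMoment_apply, sum_inner, inner_sum, inner_smul_left, inner_smul_right]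
  refine Finset.sum_congr rfl fun p _ => ?_
  rw [real_inner_comm v (Φ x p)]
  simp
  ring

theorem stronglyMeasurable_condSecondMoment [MeasurableSpace X]
    (hπ : ∀ p, Measurable fun x => π x p) (hΦ : ∀ p, StronglyMeasurable fun x => Φ x p) :
    StronglyMeasurable (condSecondMoment π Φ) := by
  have hcont : Continuous fun u : F => rankOne u u := by
    have : Continuous fun u : F => (smulRightL ℝ F F (innerSL ℝ u)) u := by fun_prop
    exact this
  unfold condSecondMoment
  refine Finset.stronglyMeasurable_fun_sum _ fun p _ => ?_
  exact (hπ p).stronglyMeasurable.smul (hcont.comp_stronglyMeasurable (hΦ p))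

theorem norm_condSecondMoment_le (hπ0 : ∀ x p, 0 ≤ π x p) (hπ1 : ∀ x, ∑ p, π x p = 1)
    {M : ℝ} (hM : ∀ x p, ‖Φ x p‖ ≤ M) (x : X) : ‖condSecondMoment π Φ x‖ ≤ M * M := by
  calc ‖condSecondMoment π Φ x‖ ≤ ∑ p, π x p * (M * M) := by
        refine (norm_sum_le _ _).trans (Finset.sum_le_sum fun p _ => ?_)
        rw [norm_smul, Real.norm_of_nonneg (hπ0 x p), rankOne, norm_smulRight_apply,
          innerSL_apply_norm]
        have h := hM x p
        have h0 := hπ0 x p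
        have hM0 : 0 ≤ M := (norm_nonneg _).trans h
        gcongr
    _ = M * M := by rw [← Finset.sum_mul, hπ1, one_mul]

theorem inner_condSecondMoment_comp (N M : F →L[ℝ] F) [CompleteSpace F] (x y : X) (v : F) :
    ⟪N v, condSecondMoment π Φ x (M (condSecondMoment π Φ y v))⟫ =
      ∑ p, ∑ p', ⟪v, (π x p * π y p' * ⟪Φ x p, M (Φ y p')⟫) • adjoint N (Φ x p)⟫ *
        ⟪Φ y p', v⟫ := by
  simp only [condSecondMoment_apply, map_sum, map_smul, inner_sum, inner_smul_right,
    Finset.mul_sum, adjoint_inner_right]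
  rw [Finset.sum_comm]
  refine Finset.sum_congr rfl fun p _ => Finset.sum_congr rfl fun p' _ => ?_
  ring

theorem hasSum_integral_inner_condSecondMoment {ι Ω : Type*} [Countable ι] [CompleteSpace F]
    [MeasurableSpace X] [MeasurableSpace Ω] (b : HilbertBasis ι ℝ F)
    (hπ0 : ∀ x p, 0 ≤ π x p) (hπ1 : ∀ x, ∑ p, π x p = 1)
    (hπ : ∀ p, Measurable fun x => π x p) (hΦ : ∀ p, StronglyMeasurable fun x => Φ x p)
    (hb : ∃ M, ∀ x p, ‖Φ x p‖ ≤ M) (N M : F →L[ℝ] F)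
    (μ : Measure Ω) [IsFiniteMeasure μ] {s t : Ω → X} (hs : Measurable s) (ht : Measurable t) :
    HasSum
      (fun i => ∫ z, ⟪N (b i), condSecondMoment π Φ (s z)
        (M (condSecondMoment π Φ (t z) (b i)))⟫ ∂μ)
      (∫ z, ∑ p, ∑ p', π (s z) p * π (t z) p' *
        (⟪Φ (s z) p, M (Φ (t z) p')⟫ * ⟪Φ (s z) p, N (Φ (t z) p')⟫) ∂μ) := by
  obtain ⟨K, hK⟩ := hb
  have hg (p' : P) : MemLp (fun z => Φ (t z) p') 2 μ :=
    .of_bound ((hΦ p').comp_measurable ht).aestronglyMeasurable K (.of_forall fun z => hK _ _)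
  have hf (p p' : P) : MemLp (fun z => (π (s z) p * π (t z) p' * ⟪Φ (s z) p, M (Φ (t z) p')⟫) •
      adjoint N (Φ (s z) p)) 2 μ := by
    refine .of_bound (StronglyMeasurable.aestronglyMeasurable ?_)
      (1 * 1 * (K * (‖M‖ * K)) * (‖adjoint N‖ * K)) (.of_forall fun z => ?_)
    · have h1 := (hΦ p).comp_measurable hs
      have h2 := M.continuous.comp_stronglyMeasurable ((hΦ p').comp_measurable ht)
      exact ((((hπ p).comp hs).mul ((hπ p').comp ht)).stronglyMeasurable.mul (h1.inner h2)).smul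
        ((adjoint N).continuous.comp_stronglyMeasurable h1)
    · have hK0 : 0 ≤ K := (norm_nonneg _).trans (hK (s z) p)
      rw [norm_smul, norm_mul, norm_mul]
      gcongr
      · exact norm_weight_le_one hπ0 hπ1 _ _
      · exact norm_weight_le_one hπ0 hπ1 _ _
      · exact (norm_inner_le_norm _ _).trans (mul_le_mul (hK _ _) (M.le_opNorm_of_le (hK _ _))
          (norm_nonneg _) hK0)
      · exact (adjoint N).le_opNorm_of_le (hK _ _)
  have hterm (i : ι) (p p' : P) : Integrable (fun z =>
      ⟪(b i : F), (π (s z) p * π (t z) p' * ⟪Φ (s z) p, M (Φ (t z) p')⟫) •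
        adjoint N (Φ (s z) p)⟫ * ⟪Φ (t z) p', b i⟫) μ :=
    ((hf p p').const_inner (b i)).integrable_mul ((hg p').inner_const (b i))
  simp_rw [inner_condSecondMoment_comp]
  simp_rw [integral_finsetSum _ fun p _ => integrable_finsetSum _ fun p' _ =>
      integrable_inner_mul_inner hπ0 hπ1 hπ hΦ ⟨K, hK⟩ N M μ hs ht p p',
    integral_finsetSum _ fun p' _ =>
      integrable_inner_mul_inner hπ0 hπ1 hπ hΦ ⟨K, hK⟩ N M μ hs ht _ p',
    integral_finsetSum _ fun p _ => integrable_finsetSum _ fun p' _ => hterm _ p p',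
    integral_finsetSum _ fun p' _ => hterm _ _ p']
  refine hasSum_sum fun p _ => hasSum_sum fun p' _ => ?_
  convert b.hasSum_integral_inner_mul_inner (hf p p') (hg p') using 3 with z
  rw [inner_smul_right, adjoint_inner_right, real_inner_comm (Φ (s z) p)]
  ring

end condSecondMoment

theorem inner_integral_centered_comp {X F : Type*} [MeasurableSpace X] [NormedAddCommGroup F]
    [InnerProductSpace ℝ F] [CompleteSpace F] (ρ : Measure X) [IsProbabilityMeasure ρ]
    {S : X → F →L[ℝ] F} (hS : StronglyMeasurable S) {K : ℝ} (hK : ∀ x, ‖S x‖ ≤ K)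
    {C : F →L[ℝ] F} (hC : C = ∫ x, S x ∂ρ) (T : F →L[ℝ] F) (v w : F) :
    ∫ x, ⟪v, (S x - C) (T ((S x - C) w))⟫ ∂ρ =
      (∫ x, ⟪v, S x (T (S x w))⟫ ∂ρ) -
        ∫ z, ⟪v, S z.1 (T (S z.2 w))⟫ ∂(ρ.prod ρ) := by
  have hSint : Integrable S ρ := .of_bound hS.aestronglyMeasurable K (.of_forall hK)
  have hL (u u' : F) : Integrable (fun x => ⟪u, S x u'⟫) ρ ∧ ∫ x, ⟪u, S x u'⟫ ∂ρ = ⟪u, C u'⟫ := by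
    let L : (F →L[ℝ] F) →L[ℝ] ℝ := (innerSL ℝ u) ∘L (apply ℝ F u')
    exact ⟨L.integrable_comp hSint, by rw [hC]; exact L.integral_comp_comm hSint⟩
  have hbil {Ω : Type _} [MeasurableSpace Ω] (μ : Measure Ω) [IsFiniteMeasure μ] {s t : Ω → X}
      (hs : Measurable s) (ht : Measurable t) :
      Integrable (fun z => ⟪v, S (s z) (T (S (t z) w))⟫) μ := by
    refine .of_bound (StronglyMeasurable.aestronglyMeasurable ?_)
      (‖v‖ * (K * (‖T‖ * (K * ‖w‖)))) (.of_forall fun z => ?_)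
    · have h1 := T.continuous.comp_stronglyMeasurable
        ((apply ℝ F w).continuous.comp_stronglyMeasurable (hS.comp_measurable ht))
      exact stronglyMeasurable_const.inner
        (isBoundedBilinearMap_apply.continuous.comp_stronglyMeasurable
          ((hS.comp_measurable hs).prodMk h1))
    · refine (norm_inner_le_norm _ _).trans (mul_le_mul_of_nonneg_left ?_ (norm_nonneg v))
      exact le_of_opNorm_le_of_le _ (hK _) (T.le_opNorm_of_le (le_of_opNorm_le _ (hK _) _))
  have hadj (u : F) : Integrable (fun x => ⟪v, C (T (S x u))⟫) ρ ∧
      ∫ x, ⟪v, C (T (S x u))⟫ ∂ρ = ⟪v, C (T (C u))⟫ := by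
    simpa only [adjoint_inner_left, coe_comp, Function.comp_apply] using
      hL (adjoint (C ∘L T) v) u
  have hprod : ∫ z, ⟪v, S z.1 (T (S z.2 w))⟫ ∂(ρ.prod ρ) = ⟪v, C (T (C w))⟫ := by
    rw [integral_prod _ (hbil (ρ.prod ρ) measurable_fst measurable_snd), ← (hL v (T (C w))).2]
    refine integral_congr_ae (.of_forall fun x => ?_)
    simpa only [adjoint_inner_left, coe_comp, Function.comp_apply] using
      (hL (adjoint (S x ∘L T) v) w).2
  have hdiag := hbil ρ measurable_id measurable_id
  simp only [id] at hdiag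
  have hexp (x : X) : ⟪v, (S x - C) (T ((S x - C) w))⟫ =
      ⟪v, S x (T (S x w))⟫ - ⟪v, S x (T (C w))⟫ - (⟪v, C (T (S x w))⟫ - ⟪v, C (T (C w))⟫) := by
    simp only [sub_apply, map_sub, inner_sub_right]
    ring
  simp_rw [hexp]
  have hdiff : Integrable (fun x => ⟪v, S x (T (S x w))⟫ - ⟪v, S x (T (C w))⟫) ρ :=
    hdiag.sub (hL _ _).1
  have hdiff' : Integrable (fun x => ⟪v, C (T (S x w))⟫ - ⟪v, C (T (C w))⟫) ρ :=
    (hadj w).1.sub (integrable_const _)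
  rw [integral_sub hdiff hdiff', integral_sub hdiag (hL _ _).1,
    integral_sub (hadj w).1 (integrable_const _), (hL _ _).2, (hadj w).2, hprod]
  simp

theorem hasSum_integral_inner_centered {X P F ι : Type*} [Countable ι] [Fintype P]
    [NormedAddCommGroup F] [InnerProductSpace ℝ F] [CompleteSpace F] [MeasurableSpace X]
    (b : HilbertBasis ι ℝ F) (ρ : Measure X) [IsProbabilityMeasure ρ]
    {π : X → P → ℝ} {Φ : X → P → F} (hπ0 : ∀ x p, 0 ≤ π x p) (hπ1 : ∀ x, ∑ p, π x p = 1)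
    (hπ : ∀ p, Measurable fun x => π x p) (hΦ : ∀ p, StronglyMeasurable fun x => Φ x p)
    (hb : ∃ M, ∀ x p, ‖Φ x p‖ ≤ M) {C : F →L[ℝ] F} (hC : C = ∫ x, condSecondMoment π Φ x ∂ρ)
    (N M : F →L[ℝ] F) :
    HasSum
      (fun i => ∫ x, ⟪N (b i), (condSecondMoment π Φ x - C)
        (M ((condSecondMoment π Φ x - C) (b i)))⟫ ∂ρ)
      ((∫ x, ∑ p, ∑ p', π x p * π x p' *
          (⟪Φ x p, M (Φ x p')⟫ * ⟪Φ x p, N (Φ x p')⟫) ∂ρ)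
        - ∫ x, ∫ x', ∑ p, ∑ p', π x p * π x' p' *
          (⟪Φ x p, M (Φ x' p')⟫ * ⟪Φ x p, N (Φ x' p')⟫) ∂ρ ∂ρ) := by
  obtain ⟨K, hK⟩ := hb
  simp_rw [inner_integral_centered_comp ρ (stronglyMeasurable_condSecondMoment hπ hΦ)
    (norm_condSecondMoment_le hπ0 hπ1 hK) hC]
  have hint := integrable_finsetSum Finset.univ fun p _ =>
    integrable_finsetSum Finset.univ fun p' _ =>
      integrable_inner_mul_inner hπ0 hπ1 hπ hΦ ⟨K, hK⟩ N M (ρ.prod ρ)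
        measurable_fst measurable_snd p p'
  rw [← integral_prod _ hint]
  exact (hasSum_integral_inner_condSecondMoment b hπ0 hπ1 hπ hΦ ⟨K, hK⟩ N M ρ
    measurable_id measurable_id).sub
      (hasSum_integral_inner_condSecondMoment b hπ0 hπ1 hπ hΦ ⟨K, hK⟩ N M (ρ.prod ρ)
        measurable_fst measurable_snd)

/-- **`T_B ≤ ‖𝖦‖² Tr(𝔠)` when `g*(x,p) = 𝖦 Φ(x,p)` for a Hilbert–Schmidt `𝖦`.**
With `ζ_{x,p} = Φ(x,p)⊗Φ(x,p) - C`, `𝔠 = ∫ ζ_{x,p} ζ_{x,p'} dπ dπ dρ_X`, and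
`T_B = 𝔟₁ - 𝔟₂` computed with `g* = 𝖦 ∘ Φ`:
`𝔠` is positive semidefinite, `T_B = Tr(𝖦*𝖦 𝔠)`, and `T_B ≤ ‖𝖦‖² Tr(𝔠)`. -/
theorem stmt_10 {X P F H : Type*} [MeasurableSpace X] [Fintype P]
    [NormedAddCommGroup F] [InnerProductSpace ℝ F] [CompleteSpace F]
    [MeasurableSpace F] [BorelSpace F]
    [NormedAddCommGroup H] [InnerProductSpace ℝ H] [CompleteSpace H]
    {ι : Type*} [Countable ι] (bF : HilbertBasis ι ℝ F)
    (ρX : Measure X) [IsProbabilityMeasure ρX]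
    (π : X → P → ℝ) (hπ0 : ∀ x p, 0 ≤ π x p) (hπ1 : ∀ x, ∑ p, π x p = 1)
    (hπm : ∀ p, Measurable fun x => π x p)
    (Φ : X → P → F) (hΦm : ∀ p, Measurable fun x => Φ x p)
    (hΦb : ∃ M, ∀ x p, ‖Φ x p‖ ≤ M)
    (Gop : F →L[ℝ] H) (hGopHS : Summable fun i => ‖Gop (bF i)‖ ^ 2)
    (C : F →L[ℝ] F)
    (hC : C = ∫ x, (∑ p, π x p • rankOne (Φ x p) (Φ x p)) ∂ρX)
    (𝔠 : F →L[ℝ] F)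
    (h𝔠 : 𝔠 = ∫ x, (∑ p, ∑ p', (π x p * π x p') •
        ((rankOne (Φ x p) (Φ x p) - C) ∘L (rankOne (Φ x p') (Φ x p') - C))) ∂ρX)
    (TB : ℝ)
    (hTB : TB =
        (∫ x, ∑ p, ∑ p', π x p * π x p' *
            (⟪Gop (Φ x p), Gop (Φ x p')⟫ * ⟪Φ x p, Φ x p'⟫) ∂ρX)
        - ∫ x, ∫ x', ∑ p, ∑ p', π x p * π x' p' *
            (⟪Gop (Φ x p), Gop (Φ x' p')⟫ * ⟪Φ x p, Φ x' p'⟫) ∂ρX ∂ρX) :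
    𝔠.IsPositive
    ∧ TB = traceAlong bF ((adjoint Gop ∘L Gop) ∘L 𝔠)
    ∧ TB ≤ ‖Gop‖ ^ 2 * traceAlong bF 𝔠 := by
  have : SecondCountableTopology F := bF.secondCountableTopology
  have hΦs (p : P) : StronglyMeasurable fun x => Φ x p := (hΦm p).stronglyMeasurable
  obtain ⟨K, hK⟩ := hΦb
  set S := condSecondMoment π Φ with hS
  have hSm : StronglyMeasurable S := stronglyMeasurable_condSecondMoment hπm hΦs
  have hSb (x : X) : ‖S x‖ ≤ K * K := norm_condSecondMoment_le hπ0 hπ1 hK x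
  have hSint : Integrable S ρX := .of_bound hSm.aestronglyMeasurable _ (.of_forall hSb)
  replace hC : C = ∫ x, S x ∂ρX := hC
  have hquadC (v w : F) : ∫ x, ⟪v, S x w⟫ ∂ρX = ⟪v, C w⟫ := by
    rw [hC]
    exact ((innerSL ℝ v) ∘L (apply ℝ F w)).integral_comp_comm hSint
  have hCsymm (v w : F) : ⟪C v, w⟫ = ⟪v, C w⟫ := by
    rw [real_inner_comm, ← hquadC, ← hquadC]
    exact integral_congr_ae (.of_forall fun x =>
      (real_inner_comm _ _).trans (inner_condSecondMoment_comm x v w))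
  have hDsymm (x : X) (v w : F) : ⟪(S x - C) v, w⟫ = ⟪v, (S x - C) w⟫ := by
    simp only [sub_apply, inner_sub_left, inner_sub_right, hCsymm, hS,
      inner_condSecondMoment_comm]
  have hDm : StronglyMeasurable fun x => S x - C := hSm.sub stronglyMeasurable_const
  have hDb (x : X) : ‖S x - C‖ ≤ K * K + ‖C‖ := (norm_sub_le _ _).trans (by grw [hSb x])
  have hDD : Integrable (fun x => (S x - C) * (S x - C)) ρX :=
    .of_bound (hDm.mul hDm).aestronglyMeasurable ((K * K + ‖C‖) * (K * K + ‖C‖))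
      (.of_forall fun x => (norm_mul_le _ _).trans (mul_le_mul (hDb x) (hDb x) (norm_nonneg _)
        ((norm_nonneg _).trans (hDb x))))
  replace h𝔠 : 𝔠 = ∫ x, (S x - C) * (S x - C) ∂ρX := by
    rw [h𝔠]
    refine integral_congr_ae (.of_forall fun x => ?_)
    have hD : S x - C = ∑ p, π x p • (rankOne (Φ x p) (Φ x p) - C) := by
      simp [smul_sub, ← Finset.sum_smul, hπ1, hS, condSecondMoment]
    simp only [hD, Finset.sum_mul_sum, smul_mul_smul_comm]
    rfl
  have hquad (v w : F) : ⟪v, 𝔠 w⟫ = ∫ x, ⟪v, (S x - C) ((S x - C) w)⟫ ∂ρX := by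
    rw [h𝔠]
    exact (((innerSL ℝ v) ∘L (apply ℝ F w)).integral_comp_comm hDD).symm
  have hsum := hasSum_integral_inner_centered bF ρX hπ0 hπ1 hπm hΦs ⟨K, hK⟩ hC
  have htrace : HasSum (fun i => ⟪bF i, 𝔠 (bF i)⟫) (traceAlong bF 𝔠) := by
    refine Summable.hasSum ?_
    simpa only [hquad, ContinuousLinearMap.id_apply] using (hsum (.id ℝ F) (.id ℝ F)).summable
  set A := adjoint Gop ∘L Gop with hA
  have hAinner (u v : F) : ⟪u, A v⟫ = ⟪Gop u, Gop v⟫ := by simp [hA, adjoint_inner_right]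
  have hAsymm (u v : F) : ⟪u, A v⟫ = ⟪A u, v⟫ := by
    rw [hAinner, real_inner_comm, ← hAinner, real_inner_comm]
  have hTB_left : HasSum (fun i => ⟪bF i, (A ∘L 𝔠) (bF i)⟫) TB := by
    have h := hsum A (.id ℝ F)
    simp only [ContinuousLinearMap.id_apply, ← hS, ← hquad, hAinner] at h
    simp only [comp_apply, hAsymm, hTB]
    simpa only [mul_comm ⟪Gop _, _⟫] using h
  have hTB_sandwich : HasSum (fun i => ∫ x, ‖Gop ((S x - C) (bF i))‖ ^ 2 ∂ρX) TB := by
    have h := hsum (.id ℝ F) A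
    simpa only [ContinuousLinearMap.id_apply, ← hS, ← hDsymm, hAinner,
      real_inner_self_eq_norm_sq, ← hTB] using h
  have hdiag (v : F) : ⟪v, 𝔠 v⟫ = ∫ x, ‖(S x - C) v‖ ^ 2 ∂ρX := by
    rw [hquad]
    exact integral_congr_ae (.of_forall fun x =>
      (hDsymm x _ _).symm.trans (real_inner_self_eq_norm_sq _))
  refine ⟨(isPositive_iff 𝔠).2 ⟨fun v w => ?_, fun v => ?_⟩, hTB_left.tsum_eq.symm, ?_⟩
  · change ⟪𝔠 v, w⟫ = ⟪v, 𝔠 w⟫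
    rw [real_inner_comm, hquad, hquad]
    exact integral_congr_ae (.of_forall fun x =>
      (real_inner_comm _ _).trans ((hDsymm x _ _).trans (hDsymm x _ _)))
  · rw [real_inner_comm, hdiag]
    exact integral_nonneg fun x => sq_nonneg _
  · refine hasSum_le (fun i => ?_) hTB_sandwich (htrace.mul_left (‖Gop‖ ^ 2))
    rw [hdiag, ← integral_const_mul]
    refine integral_mono_of_nonneg (.of_forall fun x => sq_nonneg _) (.const_mul ?_ _)
      (.of_forall fun x => ?_)
    · have hev := ((apply ℝ F (bF i)).continuous.comp_stronglyMeasurable hDm).aestronglyMeasurable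
        (μ := ρX)
      exact (MemLp.of_bound (p := 2) hev ((K * K + ‖C‖) * ‖bF i‖)
        (.of_forall fun x => le_of_opNorm_le _ (hDb x) _)).integrable_norm_pow two_ne_zero
    · simp only [← mul_pow]
      gcongr
      exact Gop.le_opNorm _
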